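/- arXiv:2106.10903 — 2 statements merged into one kernel-verified Lean document; each statement's English description precedes it below -/
import Mathlib

section
/- Let q = 2^m with m even, m ≥ 4. The incidence structure (U_{q+1}, B^b_{σ_{6,2},q+1}), where B^b_{σ_{6,2},q+1} is the set of 6-subsets B of U_{q+1} with σ_{6,2}(B − a) = 0 for some a ∈ B, is a 3-(q+1, 6, 2q−8) design. -/
open Finset

attribute [local instance] Classical.propDecidable

/-- The `l`-th elementary symmetric polynomial evaluated on a finite set `B`. -/
noncomputable def esym {F : Type*} [CommRing F] (B : Finset F) (l : ℕ) : F :=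
  ∑ s ∈ B.powersetCard l, ∏ x ∈ s, x

/-- The set of `n`-th roots of unity. -/
def rootsSet (F : Type*) [Monoid F] (n : ℕ) : Set F := {u | u ^ n = 1}

section SteinerSystem

variable {α : Type*} {U : Finset α} {𝓑 : Finset (Finset α)}

/-- A Steiner system `S(3, 5, n)` on the point set `U` with blocks `𝓑`. -/
structure IsSteinerThreeFive (U : Finset α) (𝓑 : Finset (Finset α)) : Prop where
  subset : ∀ C ∈ 𝓑, C ⊆ U
  card : ∀ C ∈ 𝓑, #C = 5
  exists_block : ∀ T ⊆ U, #T = 3 → ∃ C ∈ 𝓑, T ⊆ C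
  unique_block : ∀ C ∈ 𝓑, ∀ D ∈ 𝓑, ∀ T, #T = 3 → T ⊆ C → T ⊆ D → C = D

namespace IsSteinerThreeFive

theorem eq_of_three_le_card_inter (h : IsSteinerThreeFive U 𝓑) {C D : Finset α} (hC : C ∈ 𝓑)
    (hD : D ∈ 𝓑) (hCD : 3 ≤ #(C ∩ D)) : C = D := by
  obtain ⟨T, hT, hT3⟩ := exists_subset_card_eq hCD
  exact h.unique_block C hC D hD T hT3 (hT.trans inter_subset_left) (hT.trans inter_subset_right)

theorem eq_of_subset_of_subset (h : IsSteinerThreeFive U 𝓑) {B C D : Finset α} (hC : C ∈ 𝓑)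
    (hD : D ∈ 𝓑) (hB : #B = 6) (hCB : C ⊆ B) (hDB : D ⊆ B) : C = D := by
  apply h.eq_of_three_le_card_inter hC hD
  have h1 := card_union_add_card_inter C D
  have h2 := card_le_card (union_subset hCB hDB)
  rw [h.card C hC, h.card D hD] at h1
  omega

/-- The blocks through `P` that avoid `e` partition, outside `P`, the complement of the block
through `P` and `e`. -/
theorem three_mul_card_blocks (h : IsSteinerThreeFive U 𝓑) {P C₀ : Finset α} {e : α}
    (hP : #P = 2) (heP : e ∉ P) (hC₀ : C₀ ∈ 𝓑) (hPC₀ : P ⊆ C₀) (heC₀ : e ∈ C₀) :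
    3 * #{C ∈ 𝓑 | P ⊆ C ∧ e ∉ C} = #U - 5 := by
  have hpart : U \ C₀ = ({C ∈ 𝓑 | P ⊆ C ∧ e ∉ C} : Finset (Finset α)).biUnion (fun C => C \ P) := by
    ext x
    simp only [mem_sdiff, mem_biUnion, mem_filter]
    constructor
    · rintro ⟨hxU, hxC₀⟩
      have hxP : x ∉ P := fun hx => hxC₀ (hPC₀ hx)
      obtain ⟨C, hC, hTC⟩ := h.exists_block (insert x P)
        (insert_subset hxU (hPC₀.trans (h.subset C₀ hC₀)))
        (by rw [card_insert_of_notMem hxP, hP])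
      have hPC : P ⊆ C := (subset_insert x P).trans hTC
      have hxC : x ∈ C := hTC (mem_insert_self x P)
      refine ⟨C, ⟨hC, hPC, fun heC => hxC₀ ?_⟩, hxC, hxP⟩
      have := h.unique_block C hC C₀ hC₀ (insert e P) (by rw [card_insert_of_notMem heP, hP])
        (insert_subset heC hPC) (insert_subset heC₀ hPC₀)
      exact this ▸ hxC
    · rintro ⟨C, ⟨hC, hPC, heC⟩, hxC, hxP⟩
      refine ⟨h.subset C hC hxC, fun hxC₀ => heC ?_⟩
      have := h.unique_block C hC C₀ hC₀ (insert x P) (by rw [card_insert_of_notMem hxP, hP])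
        (insert_subset hxC hPC) (insert_subset hxC₀ hPC₀)
      exact this ▸ heC₀
  rw [← h.card C₀ hC₀, ← card_sdiff_of_subset (h.subset C₀ hC₀), hpart, card_biUnion,
    sum_const_nat (m := 3), mul_comm]
  · intro C hC
    rw [mem_filter] at hC
    rw [card_sdiff_of_subset hC.2.1, h.card C hC.1, hP]
  · intro C hC D hD hCD
    rw [mem_coe, mem_filter] at hC hD
    rw [Function.onFun, disjoint_left]
    intro x hxC hxD
    rw [mem_sdiff] at hxC hxD
    exact hCD (h.unique_block C hC.1 D hD.1 (insert x P)
      (by rw [card_insert_of_notMem hxC.2, hP]) (insert_subset hxC.1 hC.2.1)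
      (insert_subset hxD.1 hD.2.1))

/-- The pairs of a block and a further point whose union contains a given `3`-subset. -/
theorem card_flags (h : IsSteinerThreeFive U 𝓑) {E : Finset α} (hEU : E ⊆ U) (hE : #E = 3) :
    #{p ∈ 𝓑 ×ˢ U | p.2 ∉ p.1 ∧ E ⊆ insert p.2 p.1} = 2 * (#U - 5) := by
  obtain ⟨C₀, hC₀, hEC₀⟩ := h.exists_block E hEU hE
  rw [← card_filter_add_card_filter_not (fun p : Finset α × α => E ⊆ p.1), two_mul]
  congr 1
  · have : ({p ∈ {p ∈ 𝓑 ×ˢ U | p.2 ∉ p.1 ∧ E ⊆ insert p.2 p.1} | E ⊆ p.1} :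
        Finset (Finset α × α)) = {C₀} ×ˢ (U \ C₀) := by
      ext ⟨C, a⟩
      simp only [mem_filter, mem_product, mem_singleton, mem_sdiff]
      constructor
      · rintro ⟨⟨⟨hC, ha⟩, haC, -⟩, hEC⟩
        obtain rfl := h.unique_block C hC C₀ hC₀ E hE hEC hEC₀
        exact ⟨rfl, ha, haC⟩
      · rintro ⟨rfl, ha, haC⟩
        exact ⟨⟨⟨hC₀, ha⟩, haC, hEC₀.trans (subset_insert _ _)⟩, hEC₀⟩
    rw [this, card_product, card_singleton, one_mul, card_sdiff_of_subset (h.subset C₀ hC₀),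
      h.card C₀ hC₀]
  · have hfib : ∀ e ∈ E, 3 * #{p ∈ ({p ∈ {p ∈ 𝓑 ×ˢ U | p.2 ∉ p.1 ∧ E ⊆ insert p.2 p.1} |
        ¬ E ⊆ p.1} : Finset (Finset α × α)) | p.2 = e} = #U - 5 := by
      intro e he
      rw [← h.three_mul_card_blocks (P := E.erase e) (by rw [card_erase_of_mem he, hE])
        (notMem_erase e E) hC₀ ((erase_subset e E).trans hEC₀) (hEC₀ he)]
      congr 1
      refine card_bij' (fun p _ => p.1) (fun C _ => (C, e)) ?_ ?_ ?_ ?_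
      · rintro ⟨C, a⟩ hp
        simp only [mem_filter, mem_product] at hp ⊢
        obtain ⟨⟨⟨⟨hC, -⟩, haC, hEC⟩, -⟩, rfl⟩ := hp
        exact ⟨hC, subset_insert_iff.1 hEC, haC⟩
      · intro C hC
        simp only [mem_filter, mem_product] at hC ⊢
        exact ⟨⟨⟨⟨hC.1, hEU he⟩, hC.2.2, subset_insert_iff.2 hC.2.1⟩, fun hEC => hC.2.2 (hEC he)⟩,
          trivial⟩
      · rintro ⟨C, a⟩ hp
        simp only [mem_filter] at hp
        rw [hp.2]
      · intro C _
        rfl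
    have hmaps : ∀ p ∈ ({p ∈ {p ∈ 𝓑 ×ˢ U | p.2 ∉ p.1 ∧ E ⊆ insert p.2 p.1} |
        ¬ E ⊆ p.1} : Finset (Finset α × α)), p.2 ∈ E := by
      intro p hp
      simp only [mem_filter] at hp
      by_contra hpE
      exact hp.2 ((subset_insert_iff_of_notMem hpE).1 hp.1.2.2)
    have hsum := card_eq_sum_card_fiberwise (f := Prod.snd) hmaps
    have h3 := sum_const_nat hfib
    rw [← mul_sum, ← hsum, hE] at h3
    exact Nat.eq_of_mul_eq_mul_left three_pos h3

/-- The `6`-subsets containing a block form a `3`-design. -/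
theorem card_block_extensions (h : IsSteinerThreeFive U 𝓑) {E : Finset α} (hEU : E ⊆ U)
    (hE : #E = 3) :
    #{B ∈ U.powersetCard 6 | (∃ C ∈ 𝓑, C ⊆ B) ∧ E ⊆ B} = 2 * (#U - 5) := by
  rw [← h.card_flags hEU hE]
  symm
  apply card_nbij (fun p => insert p.2 p.1)
  · rintro ⟨C, a⟩ hp
    simp only [mem_coe, mem_filter, mem_product, mem_powersetCard] at hp ⊢
    obtain ⟨⟨hC, ha⟩, haC, hE⟩ := hp
    exact ⟨⟨insert_subset ha (h.subset C hC), by rw [card_insert_of_notMem haC, h.card C hC]⟩,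
      ⟨C, hC, subset_insert _ _⟩, hE⟩
  · rintro ⟨C, a⟩ hp ⟨D, b⟩ hp' heq
    simp only [coe_filter, Set.mem_ofPred_eq, mem_product] at hp hp' heq
    obtain rfl := h.eq_of_subset_of_subset hp.1.1 hp'.1.1
      (B := insert a C) (by rw [card_insert_of_notMem hp.2.1, h.card C hp.1.1])
      (subset_insert _ _) (heq ▸ subset_insert _ _)
    have hab : a ∈ insert b C := heq ▸ mem_insert_self a C
    rw [(mem_insert.1 hab).resolve_right hp.2.1]
  · intro B hB
    simp only [coe_filter, Set.mem_ofPred_eq, mem_powersetCard] at hB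
    obtain ⟨⟨hBU, hB6⟩, ⟨C, hC, hCB⟩, hEB⟩ := hB
    obtain ⟨a, ha, rfl⟩ := exists_eq_insert_iff.2 ⟨hCB, by rw [h.card C hC, hB6]⟩
    refine ⟨(C, a), ?_, rfl⟩
    simp only [coe_filter, Set.mem_ofPred_eq, mem_product]
    exact ⟨⟨hC, hBU (mem_insert_self _ _)⟩, ha, hEB⟩

end IsSteinerThreeFive

end SteinerSystem

section ElementarySymmetric

theorem esym_zero_right {F : Type*} [CommRing F] (s : Finset F) : esym s 0 = 1 := by
  simp [esym]

theorem esym_empty_succ {F : Type*} [CommRing F] (k : ℕ) : esym (∅ : Finset F) (k + 1) = 0 := by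
  rw [esym, powersetCard_eq_empty.2 (by simp), sum_empty]

theorem esym_insert_succ {F : Type*} [CommRing F] {a : F} {s : Finset F} (ha : a ∉ s) (k : ℕ) :
    esym (insert a s) (k + 1) = esym s (k + 1) + a * esym s k := by
  unfold esym
  rw [powersetCard_succ_insert ha, sum_union, sum_image, mul_sum]
  · congr 1
    refine sum_congr rfl fun t ht => ?_
    rw [prod_insert fun h => ha ((mem_powersetCard.1 ht).1 h)]
  · intro t ht t' ht' heq
    rw [mem_coe, mem_powersetCard] at ht ht'
    rw [← erase_insert fun h => ha (ht.1 h), heq, erase_insert fun h => ha (ht'.1 h)]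
  · rw [disjoint_left]
    intro t ht ht'
    obtain ⟨r, -, rfl⟩ := mem_image.1 ht'
    exact ha ((mem_powersetCard.1 ht).1 (mem_insert_self a r))

theorem esym_two_of_card_five {F : Type*} [CommRing F] {x y z u v : F}
    (h : #({x, y, z, u, v} : Finset F) = 5) :
    esym {x, y, z, u, v} 2 =
      x * y + y * z + z * x + (x + y + z) * (u + v) + u * v := by
  have h5 : ∀ {a : F} {s : Finset F} {n : ℕ}, #s ≤ n → #(insert a s) = n + 1 → a ∉ s ∧ #s = n := by
    intro a s n hs hins
    have ha : a ∉ s := fun ha => by rw [insert_eq_of_mem ha] at hins; omega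
    rw [card_insert_of_notMem ha] at hins
    exact ⟨ha, by omega⟩
  obtain ⟨h1, h⟩ := h5 card_le_four h
  obtain ⟨h2, h⟩ := h5 card_le_three h
  obtain ⟨h3, h⟩ := h5 card_le_two h
  obtain ⟨h4, -⟩ := h5 (card_singleton v).le h
  rw [← insert_empty_eq v] at h1 h2 h3 h4 ⊢
  have h0 : ∀ {a : F} {s : Finset F}, a ∉ s → esym (insert a s) 1 = esym s 1 + a := fun ha => by
    rw [esym_insert_succ ha 0, esym_zero_right, mul_one]
  rw [esym_insert_succ h1 1, esym_insert_succ h2 1, esym_insert_succ h3 1, esym_insert_succ h4 1,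
    esym_insert_succ (notMem_empty v) 1, h0 h2, h0 h3, h0 h4, h0 (notMem_empty v),
    esym_empty_succ 0, esym_empty_succ 1]
  ring

theorem exists_eq_of_card_five {F : Type*} {C : Finset F} (hC : #C = 5) :
    ∃ x y z u v, C = {x, y, z, u, v} := by
  obtain ⟨x, s, -, rfl, hs⟩ := card_eq_succ.1 hC
  obtain ⟨y, t, -, rfl, ht⟩ := card_eq_succ.1 hs
  obtain ⟨z, u, v, -, -, -, rfl⟩ := card_eq_three.1 ht
  exact ⟨x, y, z, u, v, rfl⟩

/-- In characteristic two, `e₂` of five elements is invariant under translation. -/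
theorem esym_two_image_sub {F : Type*} [CommRing F] [CharP F 2] {C : Finset F} (hC : #C = 5)
    (a : F) : esym (C.image (fun b => b - a)) 2 = esym C 2 := by
  have hcard : #(C.image (fun b => b - a)) = 5 := by
    rw [card_image_of_injective _ (sub_left_injective), hC]
  obtain ⟨x, y, z, u, v, rfl⟩ := exists_eq_of_card_five hC
  simp only [image_insert, image_singleton] at hcard ⊢
  rw [esym_two_of_card_five hC, esym_two_of_card_five hcard]
  have h2 : (2 : F) = 0 := CharTwo.two_eq_zero
  linear_combination (5 * a ^ 2 - 2 * a * (x + y + z + u + v)) * h2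

theorem exists_esym_two_image_sub_iff {F : Type*} [CommRing F] [CharP F 2] {B : Finset F}
    (hB : #B = 6) :
    (∃ a ∈ B, esym (B.image (fun b => b - a)) 2 = 0) ↔ ∃ C ⊆ B, #C = 5 ∧ esym C 2 = 0 := by
  have key : ∀ (a : F) (C : Finset F), a ∉ C → #C = 5 →
      esym ((insert a C).image (fun b => b - a)) 2 = esym C 2 := by
    intro a C ha hC
    rw [image_insert, sub_self, esym_insert_succ, esym_two_image_sub hC, zero_mul, add_zero]
    simpa [sub_eq_zero] using ha
  constructor
  · rintro ⟨a, ha, h⟩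
    have hC : #(B.erase a) = 5 := by rw [card_erase_of_mem ha, hB]
    rw [← insert_erase ha, key a _ (notMem_erase a B) hC] at h
    exact ⟨_, erase_subset a B, hC, h⟩
  · rintro ⟨C, hCB, hC, h⟩
    obtain ⟨a, ha, rfl⟩ := exists_eq_insert_iff.2 ⟨hCB, by rw [hC, hB]⟩
    exact ⟨a, mem_insert_self a C, by rw [key a C ha hC, h]⟩

end ElementarySymmetric

section UnitCircle

variable {F : Type*} [Field F] {φ : F →+* F} {ω : F}

/-- A linear form with coefficients the cube roots of unity does not vanish on distinct points of
the unit circle. -/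
theorem linear_form_ne_zero (hω : ω ^ 2 + ω + 1 = 0) (hφω : φ ω = ω) {x y z : F}
    (hx : x * φ x = 1) (hy : y * φ y = 1) (hz : z * φ z = 1) (hxy : x ≠ y) :
    ω * x + ω ^ 2 * y + z ≠ 0 := by
  intro h
  have h' : ω * φ x + ω ^ 2 * φ y + φ z = 0 := by
    simpa [hφω] using congrArg φ h
  have h3 : ω * (y * z) + ω ^ 2 * (x * z) + x * y = 0 := by
    linear_combination (x * y * z) * h' - ω * y * z * hx - ω ^ 2 * x * z * hy - x * y * hz
  have h4 : (x - y) ^ 2 = 0 := by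
    grind
  exact hxy (sub_eq_zero.1 (pow_eq_zero_iff two_ne_zero |>.1 h4))

variable [CharP F 2]

/-- The point `u` of the unit circle whose cross ratio with `x`, `y`, `z` is a primitive cube root
of unity. -/
theorem exists_equianharmonic (hω : ω ^ 2 + ω + 1 = 0) (hφω : φ ω = ω) {x y z : F}
    (hx : x * φ x = 1) (hy : y * φ y = 1) (hz : z * φ z = 1) (hxy : x ≠ y) (hyz : y ≠ z)
    (hzx : z ≠ x) :
    ∃ u, u * φ u = 1 ∧ u * (ω * x + ω ^ 2 * y + z) = ω * (y * z) + ω ^ 2 * (x * z) + x * y ∧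
      u ≠ x ∧ u ≠ y ∧ u ≠ z := by
  have h2 : (2 : F) = 0 := CharTwo.two_eq_zero
  have hω0 : ω ≠ 0 := by rintro rfl; simp at hω
  have hd := linear_form_ne_zero hω hφω hx hy hz hxy
  have hφd := (map_ne_zero φ).2 hd
  obtain ⟨u, hu⟩ : ∃ u, u * (ω * x + ω ^ 2 * y + z) =
      ω * (y * z) + ω ^ 2 * (x * z) + x * y := ⟨_, div_mul_cancel₀ _ hd⟩
  have hφu := congrArg φ hu
  simp only [map_mul, map_add, map_pow, hφω] at hφu hφd
  refine ⟨u, ?_, hu, ?_, ?_, ?_⟩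
  · apply mul_right_cancel₀ (mul_ne_zero hd hφd)
    have h3 : ω * (y * z) + ω ^ 2 * (x * z) + x * y =
        x * y * z * (ω * φ x + ω ^ 2 * φ y + φ z) := by
      linear_combination -ω * y * z * hx - ω ^ 2 * x * z * hy - x * y * hz
    have h4 : x * y * z * (ω * (φ y * φ z) + ω ^ 2 * (φ x * φ z) + φ x * φ y) =
        ω * x + ω ^ 2 * y + z := by
      linear_combination ω * x * y * φ y * hz + ω * x * hy + ω ^ 2 * y * x * φ x * hz +
        ω ^ 2 * y * hx + z * x * φ x * hy + z * hx
    linear_combination φ u * (ω * φ x + ω ^ 2 * φ y + φ z) * hu +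
      (ω * (y * z) + ω ^ 2 * (x * z) + x * y) * hφu +
      (ω * (φ y * φ z) + ω ^ 2 * (φ x * φ z) + φ x * φ y) * h3 +
      (ω * φ x + ω ^ 2 * φ y + φ z) * h4
  · rintro rfl
    have : ω * ((u - y) * (z - u)) = 0 := by grind
    simp [hω0, sub_eq_zero, hxy, hzx] at this
  · rintro rfl
    have : ω ^ 2 * ((x - u) * (u - z)) = 0 := by grind
    simp [hω0, sub_eq_zero, hxy, hyz] at this
  · rintro rfl
    have : (u - x) * (y - u) = 0 := by grind
    simp [sub_eq_zero, hyz, hzx] at this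

/-- Three distinct points of the unit circle extend to five on which `e₂` vanishes. -/
theorem exists_completion (hω : ω ^ 2 + ω + 1 = 0) (hφω : φ ω = ω) {x y z : F}
    (hx : x * φ x = 1) (hy : y * φ y = 1) (hz : z * φ z = 1) (hxy : x ≠ y) (hyz : y ≠ z)
    (hzx : z ≠ x) :
    ∃ u v, u * φ u = 1 ∧ v * φ v = 1 ∧ #({x, y, z, u, v} : Finset F) = 5 ∧
      x * y + y * z + z * x + (x + y + z) * (u + v) + u * v = 0 := by
  have h2 : (2 : F) = 0 := CharTwo.two_eq_zero
  obtain ⟨u, hu, hud, hux, huy, huz⟩ := exists_equianharmonic hω hφω hx hy hz hxy hyz hzx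
  obtain ⟨v, hv, hvd, hvy, hvx, hvz⟩ := exists_equianharmonic hω hφω hy hx hz hxy.symm hzx.symm hyz.symm
  have hd := linear_form_ne_zero hω hφω hx hy hz hxy
  have hd' := linear_form_ne_zero hω hφω hy hx hz hxy.symm
  have huv : u ≠ v := by
    rintro rfl
    have : (u - z) * (x - y) = 0 := by grind
    simp [sub_eq_zero, hxy, huz] at this
  refine ⟨u, v, hu, hv, ?_, ?_⟩
  · rw [card_insert_of_notMem, card_insert_of_notMem, card_insert_of_notMem, card_pair huv]
    · simp [huz.symm, hvz.symm]
    · simp [huy.symm, hvy.symm, hyz]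
    · simp [hux.symm, hvx.symm, hxy, hzx.symm]
  · apply mul_right_cancel₀ (mul_ne_zero hd hd')
    have hpoly : (x * y + y * z + z * x) *
          ((ω * x + ω ^ 2 * y + z) * (ω * y + ω ^ 2 * x + z)) +
        (x + y + z) * ((ω * (y * z) + ω ^ 2 * (x * z) + x * y) * (ω * y + ω ^ 2 * x + z) +
          (ω * x + ω ^ 2 * y + z) * (ω * (x * z) + ω ^ 2 * (y * z) + y * x)) +
        (ω * (y * z) + ω ^ 2 * (x * z) + x * y) * (ω * (x * z) + ω ^ 2 * (y * z) + y * x) = 0 := by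
      clear * - hω h2
      grind
    linear_combination hpoly + (x + y + z + v) * (ω * y + ω ^ 2 * x + z) * hud +
      ((x + y + z) * (ω * x + ω ^ 2 * y + z) +
        (ω * (y * z) + ω ^ 2 * (x * z) + x * y)) * hvd

/-- The two further points extending three points of the unit circle to a zero of `e₂` are
uniquely determined. -/
theorem eq_or_eq_of_completion {x y z u v u' v' : F}
    (hx : x * φ x = 1) (hy : y * φ y = 1) (hz : z * φ z = 1) (hu : u * φ u = 1) (hv : v * φ v = 1)
    (hu' : u' * φ u' = 1) (hv' : v' * φ v' = 1) (hxy : x ≠ y) (hyz : y ≠ z) (hzx : z ≠ x)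
    (h : x * y + y * z + z * x + (x + y + z) * (u + v) + u * v = 0)
    (h' : x * y + y * z + z * x + (x + y + z) * (u' + v') + u' * v' = 0) :
    u' = u ∨ u' = v := by
  have h2 : (2 : F) = 0 := CharTwo.two_eq_zero
  have e₃ : ∀ {u v : F}, u * φ u = 1 → v * φ v = 1 →
      x * y + y * z + z * x + (x + y + z) * (u + v) + u * v = 0 →
      (x * y + y * z + z * x - (x + y + z) ^ 2) * (u + v) =
        (x + y + z) * (x * y + y * z + z * x) - x * y * z := by
    intro u v hu hv h
    have hφ := congrArg φ h
    simp only [map_mul, map_add, map_zero] at hφ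
    have hinv : ∀ {a : F}, a * φ a = 1 → a ≠ 0 ∧ φ a = a⁻¹ := fun ha =>
      ⟨left_ne_zero_of_mul_eq_one ha, eq_inv_of_mul_eq_one_right ha⟩
    obtain ⟨hx0, hxi⟩ := hinv hx
    obtain ⟨hy0, hyi⟩ := hinv hy
    obtain ⟨hz0, hzi⟩ := hinv hz
    obtain ⟨hu0, hui⟩ := hinv hu
    obtain ⟨hv0, hvi⟩ := hinv hv
    rw [hxi, hyi, hzi, hui, hvi] at hφ
    field_simp at hφ
    linear_combination hφ - (x + y + z) * h
  have hS := e₃ hu hv h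
  have hS' := e₃ hu' hv' h'
  have hne : x * y + y * z + z * x - (x + y + z) ^ 2 ≠ 0 := by
    intro h0
    rw [h0, zero_mul] at hS
    have : (x - y) * ((y - z) * (z - x)) = 0 := by grind
    simp [sub_eq_zero, hxy, hyz, hzx] at this
  have hsum : u' + v' = u + v := mul_left_cancel₀ hne (hS'.trans hS.symm)
  have hprod : u' * v' = u * v := by
    linear_combination h' - h - (x + y + z) * hsum
  have : (u' - u) * (u' - v) = 0 := by linear_combination u' * hsum - hprod
  simpa [sub_eq_zero] using this

/-- The zeros of `e₂` among the `5`-subsets of the unit circle are the blocks of a Steiner system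
`S(3, 5, n)`. -/
theorem isSteinerThreeFive_esym_two (hω : ω ^ 2 + ω + 1 = 0) (hφω : φ ω = ω) {U : Finset F}
    (hU : ∀ u, u ∈ U ↔ u * φ u = 1) :
    IsSteinerThreeFive U {C ∈ U.powersetCard 5 | esym C 2 = 0} where
  subset C hC := (mem_powersetCard.1 (mem_filter.1 hC).1).1
  card C hC := (mem_powersetCard.1 (mem_filter.1 hC).1).2
  exists_block T hTU hT := by
    obtain ⟨x, y, z, hxy, hxz, hyz, rfl⟩ := card_eq_three.1 hT
    simp only [insert_subset_iff, singleton_subset_iff, hU] at hTU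
    obtain ⟨hx, hy, hz⟩ := hTU
    obtain ⟨u, v, hu, hv, h5, h⟩ := exists_completion hω hφω hx hy hz hxy hyz hxz.symm
    refine ⟨{x, y, z, u, v}, ?_, ?_⟩
    · rw [mem_filter, mem_powersetCard, esym_two_of_card_five h5]
      simp only [insert_subset_iff, singleton_subset_iff, hU]
      exact ⟨⟨⟨hx, hy, hz, hu, hv⟩, h5⟩, h⟩
    · simp [insert_subset_iff]
  unique_block C hC D hD T hT hTC hTD := by
    obtain ⟨x, y, z, hxy, hxz, hyz, rfl⟩ := card_eq_three.1 hT
    have key : ∀ C ∈ ({C ∈ U.powersetCard 5 | esym C 2 = 0} : Finset (Finset F)),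
        {x, y, z} ⊆ C → ∃ u v, C = {x, y, z, u, v} ∧ x * φ x = 1 ∧ y * φ y = 1 ∧ z * φ z = 1 ∧
          u * φ u = 1 ∧ v * φ v = 1 ∧
          x * y + y * z + z * x + (x + y + z) * (u + v) + u * v = 0 := by
      intro C hC hTC
      rw [mem_filter, mem_powersetCard] at hC
      obtain ⟨⟨hCU, hC5⟩, h⟩ := hC
      obtain ⟨u, v, -, huv⟩ := card_eq_two.1
        (show #(C \ {x, y, z}) = 2 by rw [card_sdiff_of_subset hTC, hC5, hT])
      obtain rfl : C = {x, y, z, u, v} := by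
        rw [← union_sdiff_of_subset hTC, huv]
        simp only [insert_union, singleton_union]
      rw [esym_two_of_card_five hC5] at h
      simp only [insert_subset_iff, singleton_subset_iff, hU] at hCU
      obtain ⟨hx, hy, hz, hu, hv⟩ := hCU
      exact ⟨u, v, rfl, hx, hy, hz, hu, hv, h⟩
    have hC5 := (mem_powersetCard.1 (mem_filter.1 hC).1).2
    have hD5 := (mem_powersetCard.1 (mem_filter.1 hD).1).2
    obtain ⟨u, v, rfl, hx, hy, hz, hu, hv, h⟩ := key C hC hTC
    obtain ⟨u', v', rfl, -, -, -, hu', hv', h'⟩ := key D hD hTD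
    have hu'C := eq_or_eq_of_completion hx hy hz hu hv hu' hv' hxy hyz hxz.symm h h'
    have hv'C := eq_or_eq_of_completion hx hy hz hu hv hv' hu' hxy hyz hxz.symm h
      (by rw [add_comm v', mul_comm v', h'])
    refine (eq_of_subset_of_card_le ?_ (hC5.trans hD5.symm).le).symm
    simp only [insert_subset_iff, singleton_subset_iff, mem_insert, mem_singleton]
    tauto

end UnitCircle

section FiniteField

theorem exists_isPrimitiveRoot_of_dvd {F : Type*} [Field F] [Finite F] {n : ℕ}
    (hn : n ∣ Nat.card F - 1) : ∃ ζ : F, IsPrimitiveRoot ζ n := by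
  obtain ⟨g, hg⟩ := IsCyclic.exists_ofOrder_eq_natCard (α := Fˣ)
  obtain ⟨k, hk⟩ := hn
  have hF : 0 < Nat.card F - 1 := Nat.sub_pos_of_lt Finite.one_lt_card
  rw [Nat.card_units] at hg
  have hg' := IsPrimitiveRoot.orderOf g
  rw [hg] at hg'
  exact ⟨_, (IsPrimitiveRoot.coe_units_iff.2 (hg'.pow hF (hk.trans (mul_comm _ _))))⟩

end FiniteField

theorem stmt16 (m : ℕ) (hm : 4 ≤ m) (heven : Even m)
    (E : Finset (GaloisField 2 (2 * m)))
    (hEU : ↑E ⊆ rootsSet (GaloisField 2 (2 * m)) (2 ^ m + 1))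
    (hE : E.card = 3) :
    {B : Finset (GaloisField 2 (2 * m)) |
        ↑B ⊆ rootsSet (GaloisField 2 (2 * m)) (2 ^ m + 1) ∧ B.card = 6 ∧
          (∃ a ∈ B, esym (B.image (fun b => b - a)) 2 = 0) ∧ E ⊆ B}.ncard =
      2 * 2 ^ m - 8 := by
  have hcard : Nat.card (GaloisField 2 (2 * m)) - 1 = (2 ^ m + 1) * (2 ^ m - 1) := by
    rw [GaloisField.card 2 (2 * m) (by omega), mul_comm 2 m, pow_mul, ← Nat.sq_sub_sq, one_pow]
  have h3 : 3 ∣ 2 ^ m - 1 := by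
    obtain ⟨k, rfl⟩ := heven
    rw [← two_mul, pow_mul]
    simpa using Nat.sub_dvd_pow_sub_pow 4 1 k
  obtain ⟨ζ, hζ⟩ := exists_isPrimitiveRoot_of_dvd (hcard ▸ Nat.dvd_mul_right _ _)
  obtain ⟨ω, hω⟩ := exists_isPrimitiveRoot_of_dvd (hcard ▸ h3.mul_left (2 ^ m + 1))
  have hω2 : ω ^ 2 + ω + 1 = 0 := by
    have := hω.geom_sum_eq_zero (by norm_num)
    simp only [sum_range_succ, range_zero, sum_empty] at this
    linear_combination this
  have hφω : iterateFrobenius (GaloisField 2 (2 * m)) 2 m ω = ω := by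
    rw [iterateFrobenius_def, ← Nat.sub_add_cancel Nat.one_le_two_pow, pow_succ,
      (hω.pow_eq_one_iff_dvd _).2 h3, one_mul]
  set U := Polynomial.nthRootsFinset (2 ^ m + 1) (1 : GaloisField 2 (2 * m))
  have hmem : ∀ u, u ∈ U ↔ u ^ (2 ^ m + 1) = 1 := fun u =>
    Polynomial.mem_nthRootsFinset (Nat.succ_pos _) _
  have hUcard : #U = 2 ^ m + 1 := hζ.card_nthRootsFinset
  have hsub : ∀ B : Finset (GaloisField 2 (2 * m)),
      ↑B ⊆ rootsSet (GaloisField 2 (2 * m)) (2 ^ m + 1) ↔ B ⊆ U := fun B =>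
    forall₂_congr fun u _ => (hmem u).symm
  have hS := isSteinerThreeFive_esym_two hω2 hφω (U := U) fun u => by
    rw [hmem, iterateFrobenius_def, pow_succ']
  have hdesign := hS.card_block_extensions ((hsub E).1 hEU) hE
  rw [hUcard, ← Set.ncard_coe_finset] at hdesign
  trans 2 * (2 ^ m + 1 - 5)
  · rw [← hdesign]
    congr 1
    ext B
    simp only [Set.mem_ofPred_eq, coe_filter, mem_powersetCard, hsub, mem_filter]
    constructor
    · rintro ⟨hBU, hB, h, hEB⟩
      obtain ⟨C, hCB, hC, h⟩ := (exists_esym_two_image_sub_iff hB).1 h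
      exact ⟨⟨hBU, hB⟩, ⟨C, ⟨⟨hCB.trans hBU, hC⟩, h⟩, hCB⟩, hEB⟩
    · rintro ⟨⟨hBU, hB⟩, ⟨C, ⟨⟨-, hC⟩, h⟩, hCB⟩, hEB⟩
      exact ⟨hBU, hB, (exists_esym_two_image_sub_iff hB).2 ⟨C, hCB, hC, h⟩, hEB⟩
  · have := Nat.pow_le_pow_right two_pos hm
    omega
end

section
/- Let q = 2^m with m ≥ 5 odd. The set B^u_{σ_{7,3},q+1} of 7-subsets B of U_{q+1} for which σ_{7,3}(B − a) = 0 for some a ∈ U_{q+1} forms the block set of a 4-(q+1, 7, 7(q−8)(q−5)/6) design on point set U_{q+1}. -/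
open Finset

attribute [local instance] Classical.propDecidable

lemma Multiset.esymm_cons_succ {R : Type*} [CommSemiring R] (a : R) (s : Multiset R) (n : ℕ) :
    (a ::ₘ s).esymm (n + 1) = s.esymm (n + 1) + a * s.esymm n := by
  simp [Multiset.esymm, Multiset.powersetCard_cons, Multiset.sum_map_mul_left]

lemma Multiset.esymm_nil_succ {R : Type*} [CommSemiring R] (n : ℕ) :
    (0 : Multiset R).esymm (n + 1) = 0 := by
  simp [Multiset.esymm, Multiset.powersetCard_zero_right]

lemma Multiset.esymm_zero_right {R : Type*} [CommSemiring R] (s : Multiset R) :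
    s.esymm 0 = 1 := by
  simp [Multiset.esymm]

lemma esym_eq_esymm {F : Type*} [CommRing F] (B : Finset F) (l : ℕ) :
    esym B l = B.val.esymm l := by
  have := Finset.esymm_map_val (fun x : F => x) B l
  rw [Multiset.map_id'] at this
  exact this.symm

lemma esym_insert {F : Type*} [CommRing F] {B : Finset F} {x : F} (hx : x ∉ B) (l : ℕ) :
    esym (insert x B) (l + 1) = esym B (l + 1) + x * esym B l := by
  simp only [esym_eq_esymm, Finset.insert_val_of_notMem hx, Multiset.esymm_cons_succ]

lemma esym_zero {F : Type*} [CommRing F] (B : Finset F) : esym B 0 = 1 := by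
  simp [esym]

lemma esym_empty {F : Type*} [CommRing F] (l : ℕ) : esym (∅ : Finset F) (l + 1) = 0 := by
  simp [esym_eq_esymm, Multiset.esymm_nil_succ]

lemma Multiset.esymm_three_map_sub_of_card_six {F : Type*} [CommRing F] [CharP F 2] (a : F)
    (s : Multiset F) (hs : s.card = 6) : (s.map (· - a)).esymm 3 = s.esymm 3 := by
  have h2 : (2 : F) = 0 := CharTwo.two_eq_zero
  induction s using Quot.inductionOn with
  | h l =>
    match l, hs with
    | [b, c, d, e, f, g], _ =>
      have hl : Quot.mk (List.isSetoid F) [b, c, d, e, f, g]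
        = b ::ₘ c ::ₘ d ::ₘ e ::ₘ f ::ₘ g ::ₘ 0 := rfl
      rw [hl]
      simp only [Multiset.map_cons, Multiset.map_zero, Multiset.esymm_cons_succ,
        Multiset.esymm_nil_succ, Multiset.esymm_zero_right]
      linear_combination (-2 * a * (b*(c+d+e+f+g)+c*(d+e+f+g)+d*(e+f+g)+e*(f+g)+f*g)
        + 5 * a^2 * (b+c+d+e+f+g) - 10 * a^3) * h2

lemma exists_ringHom_eq_inv {F : Type*} [Field F] [CharP F 2] (m : ℕ) :
    ∃ φ : F →+* F, (∀ x, φ x = x ^ 2 ^ m) ∧ ∀ x, x ^ (2 ^ m + 1) = 1 → φ x = x⁻¹ := by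
  refine ⟨iterateFrobenius F 2 m, fun x => iterateFrobenius_def 2 m x, fun x hx => ?_⟩
  rw [iterateFrobenius_def]
  exact eq_inv_of_mul_eq_one_left (by rw [← pow_succ, hx])

set_option maxRecDepth 4000 in
set_option maxHeartbeats 1600000 in
lemma mem_of_esymm_three_map_sub_eq_zero {F : Type*} [Field F] [CharP F 2] {m : ℕ}
    {a : F} (ha : a ^ (2 ^ m + 1) = 1)
    (s : Multiset F) (hs : s.card = 7) (hU : ∀ b ∈ s, b ^ (2 ^ m + 1) = 1)
    (h3 : (s.map (· - a)).esymm 3 = 0) : a ∈ s := by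
  have h2 : (2 : F) = 0 := CharTwo.two_eq_zero
  have ha0 : a ≠ 0 := by rintro rfl; simp at ha
  obtain ⟨φ, -, hconj⟩ := exists_ringHom_eq_inv (F := F) m
  have hd : ∀ x : F, x ^ (2 ^ m + 1) = 1 →
      φ (x - a) = (x - a) * x⁻¹ * a⁻¹ := by
    intro x hx
    have hx0 : x ≠ 0 := by rintro rfl; simp at hx
    rw [φ.map_sub, hconj x hx, hconj a ha]
    field_simp
    linear_combination (a - x) * h2
  induction s using Quot.inductionOn with
  | h l =>
    match l, hs with
    | [b, c, d, e, f, g, k], _ =>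
      have hl : Quot.mk (List.isSetoid F) [b, c, d, e, f, g, k]
        = b ::ₘ c ::ₘ d ::ₘ e ::ₘ f ::ₘ g ::ₘ k ::ₘ 0 := rfl
      rw [hl] at hU h3 ⊢
      simp only [Multiset.map_cons, Multiset.map_zero, Multiset.esymm_cons_succ,
        Multiset.esymm_nil_succ, Multiset.esymm_zero_right, mul_zero, mul_one, zero_add] at h3
      have h0 : ∀ x ∈ b ::ₘ c ::ₘ d ::ₘ e ::ₘ f ::ₘ g ::ₘ k ::ₘ 0, x ≠ 0 := by
        rintro x hx rfl
        simpa using hU _ hx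
      have h3' := congrArg φ h3
      simp only [Multiset.mem_cons, Multiset.notMem_zero, or_false, forall_eq_or_imp,
        forall_eq] at hU h0 ⊢
      obtain ⟨hb, hc, hd', he, hf, hg, hk⟩ := hU
      obtain ⟨hb0, hc0, hd0, he0, hf0, hg0, hk0⟩ := h0
      simp only [map_add, map_mul, map_zero, hd b hb, hd c hc, hd d hd', hd e he,
        hd f hf, hd g hg, hd k hk] at h3'
      field_simp at h3'
      obtain ⟨B, rfl⟩ : ∃ B, b = B + a := ⟨b - a, by ring⟩
      obtain ⟨C, rfl⟩ : ∃ B, c = B + a := ⟨c - a, by ring⟩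
      obtain ⟨D, rfl⟩ : ∃ B, d = B + a := ⟨d - a, by ring⟩
      obtain ⟨E, rfl⟩ : ∃ B, e = B + a := ⟨e - a, by ring⟩
      obtain ⟨G, rfl⟩ : ∃ B, f = B + a := ⟨f - a, by ring⟩
      obtain ⟨H, rfl⟩ : ∃ B, g = B + a := ⟨g - a, by ring⟩
      obtain ⟨K, rfl⟩ : ∃ B, k = B + a := ⟨k - a, by ring⟩
      simp only [add_sub_cancel_right] at h3 h3'
      have key : B * C * D * E * G * H * K = 0 := by
        obtain ⟨e, he⟩ : ∃ e : ℕ → F, ∀ n, e n =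
            (B ::ₘ C ::ₘ D ::ₘ E ::ₘ G ::ₘ H ::ₘ K ::ₘ 0).esymm n := ⟨_, fun _ => rfl⟩
        have he4 := he 4
        have he5 := he 5
        have he6 := he 6
        simp only [Multiset.esymm_cons_succ, Multiset.esymm_nil_succ,
          Multiset.esymm_zero_right, mul_zero, mul_one, zero_add] at he4 he5 he6
        linear_combination h3' - a ^ 4 * h3 - (2 * a ^ 3 * e 4 + 5 * a ^ 2 * e 5 + 10 * a * e 6
          + 17 * (B * C * D * E * G * H * K)) * h2 + 4 * a ^ 3 * he4 + 10 * a ^ 2 * he5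
          + 20 * a * he6
      simpa [or_assoc] using key

lemma quadratic_ne_zero_of_pow_eq_self {F : Type*} [Field F] [CharP F 2] {m : ℕ} (hodd : Odd m)
    {w : F} (hw : w ^ 2 ^ m = w) : w ^ 2 + w + 1 ≠ 0 := by
  intro h
  have h3 : w ^ 3 = 1 := by linear_combination (w - 1) * h
  have h4 : ∀ k : ℕ, w ^ 4 ^ k = w := by
    intro k
    induction k with
    | zero => simp
    | succ k ih => rw [pow_succ, pow_mul, ih]; linear_combination w * h3
  obtain ⟨k, rfl⟩ := hodd
  rw [pow_succ, pow_mul 2 2 k, pow_mul, show 2 ^ 2 = 4 from rfl, h4] at hw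
  have h2 : (2 : F) = 0 := CharTwo.two_eq_zero
  exact one_ne_zero (α := F) (by linear_combination h - hw - w * h2)

lemma det_ne_zero {F : Type*} [Field F] [CharP F 2] {m : ℕ} (hodd : Odd m) {a b c d : F}
    (ha : a ^ (2 ^ m + 1) = 1) (hb : b ^ (2 ^ m + 1) = 1) (hc : c ^ (2 ^ m + 1) = 1)
    (hd : d ^ (2 ^ m + 1) = 1) (hac : a ≠ c) (hbd : b ≠ d) :
    (a * b + a * c + a * d + b * c + b * d + c * d) ^ 2
      + (a + b + c + d) * (a * b * c + a * b * d + a * c * d + b * c * d) ≠ 0 := by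
  intro h
  obtain ⟨φ, hpow, hconj⟩ := exists_ringHom_eq_inv (F := F) m
  have hne : ∀ x : F, x ^ (2 ^ m + 1) = 1 → x ≠ 0 := by rintro x hx rfl; simp at hx
  have ha0 := hne a ha
  have hb0 := hne b hb
  have hc0 := hne c hc
  have hd0 := hne d hd
  have hac' : a + c ≠ 0 := by rwa [Ne, CharTwo.add_eq_zero]
  have hbd' : b + d ≠ 0 := by rwa [Ne, CharTwo.add_eq_zero]
  refine quadratic_ne_zero_of_pow_eq_self hodd
    (w := (a + d) * (b + c) / ((a + c) * (b + d))) ?_ ?_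
  · have hac'' : a⁻¹ + c⁻¹ = (a + c) * (a * c)⁻¹ := by field_simp; ring
    have hbd'' : b⁻¹ + d⁻¹ = (b + d) * (b * d)⁻¹ := by field_simp; ring
    rw [← hpow, map_div₀]
    simp only [map_add, map_mul, hconj a ha, hconj b hb, hconj c hc, hconj d hd, hac'', hbd'']
    field_simp
    ring
  · field_simp
    grind

lemma exists_eq_of_card_eq_four {α : Type*} [DecidableEq α] {E : Finset α} (hE : E.card = 4) :
    ∃ a b c d, a ≠ b ∧ a ≠ c ∧ a ≠ d ∧ b ≠ c ∧ b ≠ d ∧ c ≠ d ∧ E = {a, b, c, d} := by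
  obtain ⟨a, t, hat, rfl, ht⟩ := Finset.card_eq_succ.1 hE
  obtain ⟨b, c, d, hbc, hbd, hcd, rfl⟩ := Finset.card_eq_three.1 ht
  simp only [Finset.mem_insert, Finset.mem_singleton, not_or] at hat
  exact ⟨a, b, c, d, hat.1, hat.2.1, hat.2.2, hbc, hbd, hcd, rfl⟩

lemma esym_four {F : Type*} [CommRing F] {a b c d : F} (hab : a ≠ b) (hac : a ≠ c) (had : a ≠ d)
    (hbc : b ≠ c) (hbd : b ≠ d) (hcd : c ≠ d) :
    esym {a, b, c, d} 1 = a + b + c + d ∧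
    esym {a, b, c, d} 2 = a * b + a * c + a * d + b * c + b * d + c * d ∧
    esym {a, b, c, d} 3 = a * b * c + a * b * d + a * c * d + b * c * d := by
  have h : ({a, b, c, d} : Finset F) = insert a (insert b (insert c (insert d ∅))) := rfl
  rw [h]
  have hd : d ∉ (∅ : Finset F) := by simp
  have hc : c ∉ insert d (∅ : Finset F) := by simp [hcd]
  have hb : b ∉ insert c (insert d (∅ : Finset F)) := by simp [hbc, hbd]
  have ha : a ∉ insert b (insert c (insert d (∅ : Finset F))) := by simp [hab, hac, had]
  refine ⟨?_, ?_, ?_⟩ <;>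
  · simp only [esym_insert ha, esym_insert hb, esym_insert hc, esym_insert hd, esym_empty,
      esym_zero]
    ring

lemma esym_insert_insert {F : Type*} [CommRing F] {E : Finset F} {x y : F} (hx : x ∉ E)
    (hy : y ∉ insert x E) :
    esym (insert y (insert x E)) 3
      = esym E 1 * (x * y) + esym E 2 * (x + y) + esym E 3 := by
  rw [esym_insert hy, esym_insert hx, esym_insert hx]
  ring

/-- The four points of `E` impose a nondegenerate symmetric bilinear condition on pairs. -/
lemma esym_four_facts {F : Type*} [Field F] [CharP F 2] {m : ℕ} (hodd : Odd m) {E : Finset F}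
    (hE : E.card = 4) (hU : ∀ x ∈ E, x ^ (2 ^ m + 1) = 1) :
    esym E 2 ^ 2 + esym E 1 * esym E 3 ≠ 0 ∧ esym E 1 ≠ 0 ∧
    (∀ x ∈ E, ∀ y ∈ E, esym E 1 * (x * y) + esym E 2 * (x + y) + esym E 3 ≠ 0) ∧
    ∃ t : F, ∃ φ : F →+* F, (∀ x, φ x = x ^ 2 ^ m) ∧
      φ (esym E 1) * t = esym E 3 ∧ φ (esym E 2) * t = esym E 2 ∧
      φ (esym E 3) * t = esym E 1 := by
  obtain ⟨a, b, c, d, hab, hac, had, hbc, hbd, hcd, rfl⟩ := exists_eq_of_card_eq_four hE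
  obtain ⟨h1, h2, h3⟩ := esym_four hab hac had hbc hbd hcd
  rw [h1, h2, h3]
  simp only [Finset.mem_insert, Finset.mem_singleton, forall_eq_or_imp, forall_eq] at hU
  obtain ⟨ha, hb, hc, hd⟩ := hU
  have hne : ∀ x : F, x ^ (2 ^ m + 1) = 1 → x ≠ 0 := by rintro x hx rfl; simp at hx
  have ha0 := hne a ha
  have hb0 := hne b hb
  have hc0 := hne c hc
  have hd0 := hne d hd
  have hdet := det_ne_zero hodd ha hb hc hd hac hbd
  have hpair : ∀ x ∈ ({a, b, c, d} : Finset F), ∀ y ∈ ({a, b, c, d} : Finset F),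
      (a + b + c + d) * (x * y) + (a * b + a * c + a * d + b * c + b * d + c * d) * (x + y)
        + (a * b * c + a * b * d + a * c * d + b * c * d) ≠ 0 := by
    have two : (2 : F) = 0 := CharTwo.two_eq_zero
    have key : ∀ a b c d : F, a ≠ b → a ≠ c → a ≠ d → c ≠ d →
        (a + b + c + d) * (a * b) + (a * b + a * c + a * d + b * c + b * d + c * d) * (a + b)
          + (a * b * c + a * b * d + a * c * d + b * c * d) ≠ 0 ∧
        (a + b + c + d) * (a * a) + (a * b + a * c + a * d + b * c + b * d + c * d) * (a + a)
          + (a * b * c + a * b * d + a * c * d + b * c * d) ≠ 0 := by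
      intro a b c d hab hac had hcd
      rw [Ne, ← CharTwo.add_eq_zero] at hab hac had hcd
      constructor
      · intro h
        exact mul_ne_zero (pow_ne_zero 2 hab) hcd (by grind)
      · intro h
        exact mul_ne_zero (mul_ne_zero hab hac) had (by grind)
    simp only [Finset.mem_insert, Finset.mem_singleton, forall_eq_or_imp, forall_eq]
    refine ⟨⟨?_, ?_, ?_, ?_⟩, ⟨?_, ?_, ?_, ?_⟩, ⟨?_, ?_, ?_, ?_⟩, ⟨?_, ?_, ?_, ?_⟩⟩
    · convert (key a b c d hab hac had hcd).2 using 1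
    · convert (key a b c d hab hac had hcd).1 using 1
    · convert (key a c b d hac hab had hbd).1 using 1; ring
    · convert (key a d b c had hab hac hbc).1 using 1; ring
    · convert (key a b c d hab hac had hcd).1 using 1; ring
    · convert (key b a c d hab.symm hbc hbd hcd).2 using 1; ring
    · convert (key b c a d hbc hab.symm hbd had).1 using 1; ring
    · convert (key b d a c hbd hab.symm hbc hac).1 using 1; ring
    · convert (key a c b d hac hab had hbd).1 using 1; ring
    · convert (key b c a d hbc hab.symm hbd had).1 using 1; ring
    · convert (key c b a d hbc.symm hac.symm hcd had).2 using 1; ring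
    · convert (key c d a b hcd hac.symm hbc.symm hab).1 using 1; ring
    · convert (key a d b c had hab hac hbc).1 using 1; ring
    · convert (key b d a c hbd hab.symm hbc hac).1 using 1; ring
    · convert (key c d a b hcd hac.symm hbc.symm hab).1 using 1; ring
    · convert (key d b c a hbd.symm hcd.symm had.symm hac.symm).2 using 1; ring
  obtain ⟨φ, hpow, hconj⟩ := exists_ringHom_eq_inv (F := F) m
  have hdual : ∃ t, φ (a + b + c + d) * t = a * b * c + a * b * d + a * c * d + b * c * d ∧
      φ (a * b + a * c + a * d + b * c + b * d + c * d) * t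
        = a * b + a * c + a * d + b * c + b * d + c * d ∧
      φ (a * b * c + a * b * d + a * c * d + b * c * d) * t = a + b + c + d := by
    refine ⟨a * b * c * d, ?_, ?_, ?_⟩ <;>
    · simp only [map_add, map_mul, hconj a ha, hconj b hb, hconj c hc, hconj d hd]
      field_simp
      ring
  obtain ⟨t, ht⟩ := hdual
  refine ⟨hdet, fun h => ?_, hpair, t, φ, hpow, ht⟩
  have haa := hpair a (by simp) a (by simp)
  rw [← ht.1, h, CharTwo.add_self_eq_zero] at haa
  simp at haa

lemma exists_involution {F : Type*} [Field F] [Finite F] [CharP F 2] {m : ℕ} (hodd : Odd m)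
    {E : Finset F} (hE : E.card = 4) (hU : ∀ x ∈ E, x ^ (2 ^ m + 1) = 1) :
    ∃ τ : F → F, (∀ x, x ^ (2 ^ m + 1) = 1 → τ x ^ (2 ^ m + 1) = 1 ∧
      ∀ y, esym E 1 * (x * y) + esym E 2 * (x + y) + esym E 3 = 0 ↔ y = τ x) ∧
      ∃ f, f ^ (2 ^ m + 1) = 1 ∧ ∀ x, esym E 1 * (x * x) + esym E 3 = 0 ↔ x = f := by
  have two : (2 : F) = 0 := CharTwo.two_eq_zero
  obtain ⟨hdet, h1, -, t, φ, hφ, e1, e2, e3⟩ := esym_four_facts hodd hE hU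
  have hnorm : ∀ x, x ^ (2 ^ m + 1) = φ x * x := fun x => by rw [hφ, pow_succ]
  generalize esym E 1 = s1 at *
  generalize esym E 2 = s2 at *
  generalize esym E 3 = s3 at *
  have ht : t ≠ 0 := by rintro rfl; simp [← e3] at h1
  have h3 : s3 ≠ 0 := by rintro rfl; simp [← e3] at h1
  refine ⟨fun x => (s2 * x + s3) / (s1 * x + s2), fun x hx => ?_, ?_⟩
  · have hx0 : x ≠ 0 := by rintro rfl; simp at hx
    rw [hnorm] at hx
    have hden : φ (s1 * x + s2) * (t * x) = s2 * x + s3 := by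
      rw [map_add, map_mul]
      linear_combination s3 * hx + x * e2 + φ x * x * e1
    have hnum : φ (s2 * x + s3) * (t * x) = s1 * x + s2 := by
      rw [map_add, map_mul]
      linear_combination s2 * hx + x * e3 + φ x * x * e2
    have hden0 : s1 * x + s2 ≠ 0 := by
      intro h
      rw [h, map_zero, zero_mul] at hden
      exact hdet (by linear_combination s2 * h + s1 * hden + s1 * s3 * two)
    have hnum0 : s2 * x + s3 ≠ 0 := by
      intro h
      rw [h, map_zero, zero_mul] at hnum
      exact hden0 hnum.symm
    constructor
    · rw [hnorm, map_div₀]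
      have hd0 : φ (s1 * x + s2) ≠ 0 := (map_ne_zero φ).2 hden0
      rw [div_mul_div_comm, div_eq_one_iff_eq (mul_ne_zero hd0 hden0)]
      apply mul_right_cancel₀ (mul_ne_zero ht hx0)
      linear_combination (s2 * x + s3) * hnum - (s1 * x + s2) * hden
    · intro y
      rw [eq_div_iff hden0, ← sub_eq_zero (a := y * _)]
      constructor <;> intro h
      · linear_combination h - (s2 * x + s3) * two
      · linear_combination h + (s2 * x + s3) * two
  · have hchar : ringChar F = 2 := ringChar.eq_iff.2 inferInstance
    obtain ⟨f, hf⟩ := FiniteField.isSquare_of_char_two hchar (s3 / s1)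
    have hff : s1 * (f * f) = s3 := by rw [← hf]; field_simp
    refine ⟨f, ?_, fun x => ?_⟩
    · rw [hnorm]
      have h := congrArg φ hff
      simp only [map_mul] at h
      have hsq : (φ f * f) * (φ f * f) = 1 := by
        apply mul_left_cancel₀ (mul_ne_zero h1 h3)
        linear_combination s1 * f ^ 2 * (h * t - φ f ^ 2 * e1 + e3) + s1 * hff
      grind
    · constructor
      · intro h
        have : (x - f) * (x - f) = 0 := by
          apply mul_left_cancel₀ h1
          linear_combination h + hff - s1 * x * f * two
        grind
      · rintro rfl
        linear_combination hff + s3 * two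

lemma card_filter_involution {α : Type*} [DecidableEq α] {U E : Finset α} {τ : α → α} {f : α}
    (hE : E ⊆ U) (hτU : ∀ x ∈ U, τ x ∈ U) (hττ : ∀ x ∈ U, τ (τ x) = x)
    (hEτ : ∀ x ∈ E, τ x ∉ E) (hf : f ∈ U) (hfix : ∀ x ∈ U, τ x = x ↔ x = f) :
    #{x ∈ U \ E | τ x ∉ E ∧ τ x ≠ x} + (2 * #E + 1) = #U := by
  have himg : #(E.image τ) = #E := by
    refine Finset.card_image_of_injOn fun x hx y hy h => ?_
    rw [← hττ x (hE hx), h, hττ y (hE hy)]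
  have hdisj : Disjoint E (E.image τ) := by
    rw [Finset.disjoint_right]
    simp only [Finset.mem_image, forall_exists_index, and_imp]
    rintro _ x hx rfl
    exact hEτ x hx
  have hff : τ f = f := (hfix f hf).2 rfl
  have hfE : f ∉ E := fun h => hEτ f h (by rwa [hff])
  have hfE' : f ∉ E ∪ E.image τ := by
    rw [Finset.mem_union, not_or, Finset.mem_image]
    refine ⟨hfE, ?_⟩
    rintro ⟨x, hx, rfl⟩
    exact hfE (by rwa [← hff, hττ x (hE hx)])
  have hT : #(insert f (E ∪ E.image τ)) = 2 * #E + 1 := by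
    rw [Finset.card_insert_of_notMem hfE', Finset.card_union_of_disjoint hdisj, himg]
    ring
  have hTU : insert f (E ∪ E.image τ) ⊆ U := by
    intro x
    simp only [Finset.mem_insert, Finset.mem_union, Finset.mem_image]
    rintro (rfl | h | ⟨y, hy, rfl⟩)
    · exact hf
    · exact hE h
    · exact hτU y (hE hy)
  rw [← hT, ← Finset.card_sdiff_add_card_eq_card hTU]
  congr 2
  ext x
  simp only [Finset.mem_filter, Finset.mem_sdiff, Finset.mem_insert, Finset.mem_union,
    Finset.mem_image, not_or, not_exists, not_and]
  constructor
  · rintro ⟨⟨hx, hxE⟩, hτx, hxf⟩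
    refine ⟨hx, fun h => hxf ((hfix x hx).2 h), hxE, ?_⟩
    rintro y hy rfl
    exact hτx (by rwa [hττ y (hE hy)])
  · rintro ⟨hx, hxf, hxE, h⟩
    exact ⟨⟨hx, hxE⟩, fun h' => h _ h' (hττ x hx), fun h' => hxf ((hfix x hx).1 h')⟩

lemma sum_card_insert_subset {α : Type*} [DecidableEq α] {𝒜 : Finset (Finset α)} {U : Finset α}
    {k : ℕ} (h𝒜 : 𝒜 ⊆ U.powersetCard k) (G : Finset α) :
    ∑ x ∈ U \ G, #{A ∈ 𝒜 | insert x G ⊆ A} = #{A ∈ 𝒜 | G ⊆ A} * (k - #G) := by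
  have h := Finset.sum_card_bipartiteAbove_eq_sum_card_bipartiteBelow
    (s := U \ G) (t := {A ∈ 𝒜 | G ⊆ A}) (fun x A => insert x G ⊆ A)
  simp only [Finset.bipartiteAbove, Finset.bipartiteBelow, Finset.filter_filter] at h
  have h1 : ∀ x, #{A ∈ 𝒜 | G ⊆ A ∧ insert x G ⊆ A} = #{A ∈ 𝒜 | insert x G ⊆ A} := by
    intro x
    congr 1
    ext A
    simp only [Finset.mem_filter, Finset.insert_subset_iff]
    tauto
  simp only [h1] at h
  rw [h, ← smul_eq_mul, Finset.sum_const_nat (m := k - #G), smul_eq_mul]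
  intro A hA
  rw [Finset.mem_filter] at hA
  have hAU := Finset.mem_powersetCard.1 (h𝒜 hA.1)
  rw [← hAU.2, ← Finset.card_sdiff_of_subset hA.2]
  congr 1
  ext x
  simp only [Finset.mem_filter, Finset.mem_sdiff, Finset.insert_subset_iff]
  exact ⟨fun ⟨⟨_, h1⟩, h2, _⟩ => ⟨h2, h1⟩, fun ⟨h2, h1⟩ => ⟨⟨hAU.1 h2, h1⟩, h2, hA.2⟩⟩

/-- The `6`-subsets of `U` on which the third elementary symmetric polynomial vanishes. -/
noncomputable def sextuples {F : Type*} [CommRing F] (U : Finset F) : Finset (Finset F) :=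
  {A ∈ U.powersetCard 6 | esym A 3 = 0}

lemma sextuples_subset {F : Type*} [CommRing F] (U : Finset F) :
    sextuples U ⊆ U.powersetCard 6 := Finset.filter_subset _ _

/-- The `6`-subsets in `sextuples U` form a `4`-design. -/
lemma card_sextuples_of_four {F : Type*} [Field F] [Finite F] [CharP F 2] {m : ℕ} (hodd : Odd m)
    {U E : Finset F} (hU : ∀ x, x ∈ U ↔ x ^ (2 ^ m + 1) = 1) (hEU : E ⊆ U) (hE : #E = 4) :
    #{A ∈ sextuples U | E ⊆ A} * 2 + 9 = #U := by
  have hEU' : ∀ x ∈ E, x ^ (2 ^ m + 1) = 1 := fun x hx => (hU x).1 (hEU hx)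
  obtain ⟨τ, hτ, f, hf, hff⟩ := exists_involution hodd hE hEU'
  obtain ⟨-, -, hpair, -⟩ := esym_four_facts hodd hE hEU'
  have hcount := card_filter_involution (τ := τ) (f := f) hEU
    (fun x hx => (hU _).2 (hτ x ((hU x).1 hx)).1)
    (fun x hx => by
      have h1 := hτ x ((hU x).1 hx)
      refine (((hτ _ h1.1).2 x).1 ?_).symm
      rw [← (h1.2 _).2 rfl]
      ring)
    (fun x hx h => hpair x hx _ h (((hτ x (hEU' x hx)).2 _).2 rfl))
    ((hU f).2 hf)
    (fun x hx => by
      rw [← hff, eq_comm, ← (hτ x ((hU x).1 hx)).2, CharTwo.add_self_eq_zero, mul_zero,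
        add_zero])
  rw [hE] at hcount
  have hsum := sum_card_insert_subset (sextuples_subset U) E
  rw [hE] at hsum
  rw [← hcount, ← hsum, Finset.card_filter]
  congr 1
  refine Finset.sum_congr rfl fun x hx => ?_
  rw [Finset.mem_sdiff] at hx
  have hτx := hτ x ((hU x).1 hx.1)
  have hsub : ∀ A, A ∈ sextuples U ∧ insert x E ⊆ A ↔
      (τ x ∉ E ∧ τ x ≠ x) ∧ A = insert (τ x) (insert x E) := by
    intro A
    rw [sextuples, Finset.mem_filter, Finset.mem_powersetCard]
    constructor
    · rintro ⟨⟨⟨hAU, hA⟩, h3⟩, hxA⟩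
      obtain ⟨y, hy, rfl⟩ := Finset.exists_eq_insert_iff.2
        ⟨hxA, by rw [hA, Finset.card_insert_of_notMem hx.2, hE]⟩
      rw [esym_insert_insert hx.2 hy, hτx.2] at h3
      subst h3
      simpa [and_comm] using hy
    · rintro ⟨⟨h1, h2⟩, rfl⟩
      have hy : τ x ∉ insert x E := by simp [h1, h2]
      refine ⟨⟨⟨?_, ?_⟩, ?_⟩, Finset.subset_insert _ _⟩
      · exact Finset.insert_subset ((hU _).2 hτx.1) (Finset.insert_subset hx.1 hEU)
      · rw [Finset.card_insert_of_notMem hy, Finset.card_insert_of_notMem hx.2, hE]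
      · rw [esym_insert_insert hx.2 hy, hτx.2]
  split_ifs with h
  · rw [Finset.card_eq_one]
    refine ⟨insert (τ x) (insert x E), ?_⟩
    ext A
    rw [Finset.mem_filter, hsub, Finset.mem_singleton]
    exact and_iff_right h
  · rw [Finset.card_eq_zero, Finset.filter_eq_empty_iff]
    exact fun A hA hxA => h ((hsub A).1 ⟨hA, hxA⟩).1

lemma eq_of_esym_erase_eq_zero {F : Type*} [Field F] [CharP F 2] {m : ℕ} (hodd : Odd m)
    {B : Finset F} (hB : #B = 7) (hU : ∀ x ∈ B, x ^ (2 ^ m + 1) = 1) {a a' : F} (ha : a ∈ B)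
    (ha' : a' ∈ B) (h : esym (B.erase a) 3 = 0) (h' : esym (B.erase a') 3 = 0) : a = a' := by
  by_contra hne
  have hm : a' ∈ B.erase a := Finset.mem_erase.2 ⟨Ne.symm hne, ha'⟩
  have hm' : a ∈ B.erase a' := Finset.mem_erase.2 ⟨hne, ha⟩
  have hC : #((B.erase a).erase a') = 5 := by
    rw [Finset.card_erase_of_mem hm, Finset.card_erase_of_mem ha, hB]
  rw [← Finset.insert_erase hm, esym_insert (Finset.notMem_erase _ _)] at h
  rw [← Finset.insert_erase hm', Finset.erase_right_comm,
    esym_insert (by simp)] at h'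
  have hCB : (B.erase a).erase a' ⊆ B := (Finset.erase_subset _ _).trans (Finset.erase_subset _ _)
  generalize (B.erase a).erase a' = C at *
  have e2 : esym C 2 = 0 := by
    have : (a - a') * esym C 2 = 0 := by linear_combination h' - h
    exact (mul_eq_zero.1 this).resolve_left (sub_ne_zero.2 hne)
  rw [e2, mul_zero, add_zero] at h
  obtain ⟨y, E, hy, rfl, hE⟩ := Finset.card_eq_succ.1 hC
  rw [esym_insert hy] at e2 h
  refine (esym_four_facts hodd hE fun x hx => hU x (hCB (Finset.mem_insert_of_mem hx))).1 ?_
  have two : (2 : F) = 0 := CharTwo.two_eq_zero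
  linear_combination esym E 2 * e2 - esym E 1 * h + esym E 1 * esym E 3 * two

lemma esym_image_sub {F : Type*} [Field F] [CharP F 2] {B : Finset F} (hB : #B = 7) {a : F}
    (ha : a ∈ B) : esym (B.image fun b => b - a) 3 = esym (B.erase a) 3 := by
  rw [esym_eq_esymm, esym_eq_esymm,
    Finset.image_val_of_injOn (sub_left_injective (b := a)).injOn]
  nth_rewrite 1 [← Finset.insert_erase ha]
  rw [Finset.insert_val_of_notMem (Finset.notMem_erase _ _), Multiset.map_cons,
    Multiset.esymm_cons_succ, sub_self, zero_mul, add_zero,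
    Multiset.esymm_three_map_sub_of_card_six]
  rw [Finset.card_val, Finset.card_erase_of_mem ha, hB]

lemma exists_esym_image_sub_iff {F : Type*} [Field F] [CharP F 2] {m : ℕ} {B : Finset F}
    (hB : #B = 7) (hU : ∀ x ∈ B, x ^ (2 ^ m + 1) = 1) :
    (∃ a ∈ rootsSet F (2 ^ m + 1), esym (B.image fun b => b - a) 3 = 0) ↔
      ∃ a ∈ B, esym (B.erase a) 3 = 0 := by
  constructor
  · rintro ⟨a, ha, h⟩
    have haB : a ∈ B := by
      rw [esym_eq_esymm, Finset.image_val_of_injOn (sub_left_injective (b := a)).injOn] at h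
      exact mem_of_esymm_three_map_sub_eq_zero ha B.val hB hU h
    exact ⟨a, haB, by rwa [← esym_image_sub hB haB]⟩
  · rintro ⟨a, ha, h⟩
    exact ⟨a, hU a ha, by rwa [esym_image_sub hB ha]⟩

lemma card_septuples_eq_sum {F : Type*} [Field F] [CharP F 2] {m : ℕ} (hodd : Odd m)
    {U E : Finset F} (hU : ∀ x, x ∈ U ↔ x ^ (2 ^ m + 1) = 1) :
    #{B ∈ U.powersetCard 7 | (∃ a ∈ B, esym (B.erase a) 3 = 0) ∧ E ⊆ B}
      = ∑ a ∈ U, #{A ∈ sextuples U | a ∉ A ∧ E.erase a ⊆ A} := by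
  set S := {B ∈ U.powersetCard 7 | (∃ a ∈ B, esym (B.erase a) 3 = 0) ∧ E ⊆ B} with hS
  have h := Finset.sum_card_bipartiteAbove_eq_sum_card_bipartiteBelow
    (s := U) (t := S) (fun a B => a ∈ B ∧ esym (B.erase a) 3 = 0)
  simp only [Finset.bipartiteAbove, Finset.bipartiteBelow] at h
  rw [Finset.card_eq_sum_ones]
  refine (Finset.sum_congr rfl fun B hB => ?_).trans
    (h.symm.trans (Finset.sum_congr rfl fun a ha => ?_))
  · rw [hS, Finset.mem_filter, Finset.mem_powersetCard] at hB
    obtain ⟨⟨hBU, hB⟩, ⟨a, ha, h3⟩, -⟩ := hB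
    refine (Finset.card_eq_one.2 ⟨a, ?_⟩).symm
    ext b
    rw [Finset.mem_filter, Finset.mem_singleton]
    constructor
    · rintro ⟨-, hb, hb3⟩
      exact eq_of_esym_erase_eq_zero hodd hB (fun x hx => (hU x).1 (hBU hx)) hb ha hb3 h3
    · rintro rfl
      exact ⟨hBU ha, ha, h3⟩
  · refine Finset.card_nbij' (fun B => B.erase a) (fun A => insert a A) ?_ ?_ ?_ ?_
    · intro B hB
      simp only [hS, Finset.coe_filter, Finset.mem_filter, Finset.mem_powersetCard,
        Set.mem_ofPred_eq] at hB
      obtain ⟨⟨⟨hBU, hB⟩, -, hEB⟩, haB, h3⟩ := hB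
      simp only [sextuples, Finset.coe_filter, Finset.mem_filter, Finset.mem_powersetCard,
        Set.mem_ofPred_eq]
      refine ⟨⟨⟨(Finset.erase_subset _ _).trans hBU, ?_⟩, h3⟩, Finset.notMem_erase _ _,
        Finset.erase_subset_erase _ hEB⟩
      rw [Finset.card_erase_of_mem haB, hB]
    · intro A hA
      simp only [sextuples, Finset.coe_filter, Finset.mem_filter, Finset.mem_powersetCard,
        Set.mem_ofPred_eq] at hA
      obtain ⟨⟨⟨hAU, hA⟩, h3⟩, haA, hEA⟩ := hA
      have h3' : esym ((insert a A).erase a) 3 = 0 := by rwa [Finset.erase_insert haA]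
      simp only [hS, Finset.coe_filter, Finset.mem_filter, Finset.mem_powersetCard,
        Set.mem_ofPred_eq]
      refine ⟨⟨⟨Finset.insert_subset ha hAU, ?_⟩, ⟨a, Finset.mem_insert_self _ _, h3'⟩,
        Finset.subset_insert_iff.2 hEA⟩, Finset.mem_insert_self _ _, h3'⟩
      rw [Finset.card_insert_of_notMem haA, hA]
    · intro B hB
      simp only [Finset.coe_filter, Set.mem_ofPred_eq] at hB
      exact Finset.insert_erase hB.2.1
    · intro A hA
      simp only [Finset.coe_filter, Set.mem_ofPred_eq] at hA
      exact Finset.erase_insert hA.2.1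

lemma card_septuples {F : Type*} [Field F] [Finite F] [CharP F 2] {m : ℕ} (hodd : Odd m)
    {U E : Finset F} (hU : ∀ x, x ∈ U ↔ x ^ (2 ^ m + 1) = 1) (hEU : E ⊆ U) (hE : #E = 4)
    (hcard : #U = 2 ^ m + 1) :
    #{B ∈ U.powersetCard 7 | (∃ a ∈ B, esym (B.erase a) 3 = 0) ∧ E ⊆ B}
      = 7 * (2 ^ m - 8) * (2 ^ m - 5) / 6 := by
  rw [card_septuples_eq_sum hodd hU]
  set cnt : Finset F → ℕ := fun G => #{A ∈ sextuples U | G ⊆ A} with hcnt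
  have hfour : ∀ G ⊆ U, #G = 4 → cnt G = cnt E := by
    intro G hG hG4
    have h1 := card_sextuples_of_four hodd hU hG hG4
    have h2 := card_sextuples_of_four hodd hU hEU hE
    simp only [hcnt]
    omega
  have hq : cnt E * 2 + 8 = 2 ^ m := by
    have h2 := card_sextuples_of_four hodd hU hEU hE
    simp only [hcnt]
    omega
  have hsplit : ∀ a, #{A ∈ sextuples U | a ∉ A ∧ E.erase a ⊆ A} + cnt (insert a E)
      = cnt (E.erase a) := by
    intro a
    simp only [hcnt]
    rw [← Finset.card_filter_add_card_filter_not (s := {A ∈ sextuples U | E.erase a ⊆ A})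
      (fun A => a ∉ A), Finset.filter_filter, Finset.filter_filter]
    congr 2 <;> ext A <;>
      simp only [Finset.mem_filter, Finset.insert_subset_iff, not_not]
    · tauto
    · refine and_congr_right fun _ => ⟨fun h => ⟨(Finset.erase_subset _ _).trans h.2, h.1⟩,
        fun h => ⟨h.2, ?_⟩⟩
      rw [← Finset.insert_eq_of_mem h.2]
      exact Finset.subset_insert_iff.2 h.1
  have hsum := Finset.sum_congr (rfl : U = U) fun a _ => hsplit a
  rw [Finset.sum_add_distrib] at hsum
  have hins : ∑ a ∈ U, cnt (insert a E) = 6 * cnt E := by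
    have h := sum_card_insert_subset (sextuples_subset U) E
    rw [← Finset.sum_sdiff hEU, h, hE,
      Finset.sum_congr rfl fun a ha => by rw [Finset.insert_eq_of_mem ha], Finset.sum_const, hE,
      smul_eq_mul]
    simp only [hcnt]
    ring
  have hthree : ∀ a ∈ E, cnt (E.erase a) * 3 = (2 ^ m - 2) * cnt E := by
    intro a ha
    have hG : E.erase a ⊆ U := (Finset.erase_subset _ _).trans hEU
    have hG3 : #(E.erase a) = 3 := by rw [Finset.card_erase_of_mem ha, hE]
    have h := sum_card_insert_subset (sextuples_subset U) (E.erase a)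
    rw [hG3] at h
    rw [← h, Finset.sum_congr rfl fun x hx => ?_, Finset.sum_const,
      Finset.card_sdiff_of_subset hG, hcard, hG3, smul_eq_mul]
    · congr 1
    · rw [Finset.mem_sdiff] at hx
      exact hfour _ (Finset.insert_subset hx.1 hG)
        (by rw [Finset.card_insert_of_notMem hx.2, hG3])
  have hera : (∑ a ∈ U, cnt (E.erase a)) * 3
      = (2 ^ m - 3) * cnt E * 3 + 4 * ((2 ^ m - 2) * cnt E) := by
    rw [← Finset.sum_sdiff hEU, add_mul, Finset.sum_mul E, Finset.sum_congr rfl hthree,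
      Finset.sum_const, hE, smul_eq_mul, Finset.sum_congr (s₁ := U \ E) rfl fun a ha => by
        rw [Finset.erase_eq_of_notMem (Finset.mem_sdiff.1 ha).2], Finset.sum_const,
      Finset.card_sdiff_of_subset hEU, hcard, hE, smul_eq_mul]
    rfl
  rw [hins] at hsum
  rw [← hsum] at hera
  rw [← hq] at hera ⊢
  generalize (∑ a ∈ U, #{A ∈ sextuples U | a ∉ A ∧ E.erase a ⊆ A}) = S at *
  generalize cnt E = c at *
  rw [show c * 2 + 8 - 3 = c * 2 + 5 by omega, show c * 2 + 8 - 2 = c * 2 + 6 by omega] at hera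
  rw [show c * 2 + 8 - 8 = c * 2 by omega, show c * 2 + 8 - 5 = c * 2 + 3 by omega]
  symm
  apply Nat.div_eq_of_eq_mul_left (by norm_num)
  nlinarith

lemma card_roots {F : Type*} [Field F] [Finite F] {m : ℕ} (hm : m ≠ 0)
    (hF : Nat.card F = 2 ^ (2 * m)) :
    ∃ U : Finset F, (∀ x, x ∈ U ↔ x ^ (2 ^ m + 1) = 1) ∧ #U = 2 ^ m + 1 := by
  obtain ⟨g, hg⟩ := IsCyclic.exists_ofOrder_eq_natCard (α := Fˣ)
  have hpos : 1 < 2 ^ m := Nat.one_lt_two_pow hm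
  have hord : orderOf g = (2 ^ m - 1) * (2 ^ m + 1) := by
    rw [hg, Nat.card_units, hF, mul_comm 2 m, pow_mul, mul_comm, ← Nat.sq_sub_sq, one_pow]
  have hprim := ((IsPrimitiveRoot.orderOf g).pow (by rw [hord]; exact Nat.mul_pos (by omega) (by omega)) hord)
  have hprim' : IsPrimitiveRoot ((g ^ (2 ^ m - 1) : Fˣ) : F) (2 ^ m + 1) :=
    IsPrimitiveRoot.coe_units_iff.2 hprim
  exact ⟨Polynomial.nthRootsFinset (2 ^ m + 1) (1 : F),
    fun x => Polynomial.mem_nthRootsFinset (Nat.succ_pos _) _, hprim'.card_nthRootsFinset⟩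

theorem stmt17 (m : ℕ) (hm : 5 ≤ m) (hodd : Odd m)
    (E : Finset (GaloisField 2 (2 * m)))
    (hEU : ↑E ⊆ rootsSet (GaloisField 2 (2 * m)) (2 ^ m + 1))
    (hE : E.card = 4) :
    {B : Finset (GaloisField 2 (2 * m)) |
        ↑B ⊆ rootsSet (GaloisField 2 (2 * m)) (2 ^ m + 1) ∧ B.card = 7 ∧
          (∃ a ∈ rootsSet (GaloisField 2 (2 * m)) (2 ^ m + 1),
            esym (B.image (fun b => b - a)) 3 = 0) ∧ E ⊆ B}.ncard =
      7 * (2 ^ m - 8) * (2 ^ m - 5) / 6 := by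
  obtain ⟨U, hU, hcard⟩ := card_roots (by omega) (GaloisField.card 2 (2 * m) (by omega))
  have hsub : ∀ B : Finset (GaloisField 2 (2 * m)),
      ↑B ⊆ rootsSet (GaloisField 2 (2 * m)) (2 ^ m + 1) ↔ B ⊆ U := fun B =>
    ⟨fun h x hx => (hU x).2 (h hx), fun h x hx => (hU x).1 (h hx)⟩
  rw [← card_septuples hodd hU ((hsub E).1 hEU) hE hcard, ← Set.ncard_coe_finset]
  congr 1
  ext B
  simp only [Set.mem_ofPred_eq, Finset.coe_filter, Finset.mem_powersetCard, hsub]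
  constructor
  · rintro ⟨hBU, hB, h, hEB⟩
    exact ⟨⟨hBU, hB⟩, (exists_esym_image_sub_iff hB fun x hx => (hU x).1 (hBU hx)).1 h, hEB⟩
  · rintro ⟨⟨hBU, hB⟩, h, hEB⟩
    exact ⟨hBU, hB, (exists_esym_image_sub_iff hB fun x hx => (hU x).1 (hBU hx)).2 h, hEB⟩
end
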